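/- arXiv:2506.00852 — 5 statements merged into one kernel-verified Lean document; each statement's English description precedes it below -/
import Mathlib

section
/- Let 𝒳 be a nontrivial interval of ℝ and k,K ≥ 1. If f̄ is a function on 𝒳 that is both k-piecewise monotone and K-piecewise constant, then f̄ is extremal in M_k with degree not larger than 2k + K − 1. -/
/-- VC-dimension of `𝒜` is at most `D`. -/
def VCDimLE {Y : Type*} (𝒜 : Set (Set Y)) (D : ℕ) : Prop :=
  ∀ B : Finset Y, D < B.card → ∃ C : Set Y, C ⊆ ↑B ∧ ∀ A ∈ 𝒜, (↑B ∩ A : Set Y) ≠ C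

/-- `gbar` is extremal in `𝒢` with degree at most `D`. -/
def ExtremalDegLE {Y : Type*} (𝒢 : Set (Y → ℝ)) (gbar : Y → ℝ) (D : ℕ) : Prop :=
  VCDimLE {S | ∃ g ∈ 𝒢, S = {y | gbar y < g y}} D ∧
  VCDimLE {S | ∃ g ∈ 𝒢, S = {y | g y < gbar y}} D

/-- `P` is a partition of `𝒳` into nontrivial (i.e. containing at least two points)
intervals. -/
def IsIntervalPartition (𝒳 : Set ℝ) (P : Finset (Set ℝ)) : Prop :=
  (∀ J ∈ P, J.OrdConnected ∧ J.Nontrivial ∧ J ⊆ 𝒳) ∧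
  ∀ y ∈ 𝒳, ∃! J, J ∈ P ∧ y ∈ J

/-- `f` is `k`-piecewise monotone on `𝒳`: monotone on each element of some partition
of `𝒳` into at most `k` nontrivial intervals. -/
def PiecewiseMono (𝒳 : Set ℝ) (k : ℕ) (f : ℝ → ℝ) : Prop :=
  ∃ P : Finset (Set ℝ), P.card ≤ k ∧ IsIntervalPartition 𝒳 P ∧
    ∀ J ∈ P, MonotoneOn f J ∨ AntitoneOn f J

/-- `f` is `K`-piecewise constant on `𝒳`: constant on each element of some partition
of `𝒳` into at most `K` nontrivial intervals. -/
def PiecewiseConst (𝒳 : Set ℝ) (K : ℕ) (f : ℝ → ℝ) : Prop :=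
  ∃ P : Finset (Set ℝ), P.card ≤ K ∧ IsIntervalPartition 𝒳 P ∧
    ∀ J ∈ P, ∃ c : ℝ, ∀ y ∈ J, f y = c

/-- Given a finite set `B` in a linear order and a map `q` with order-convex fibres taking few
values on `B`, there is a monotone counter `n` increasing by one between any two consecutive points
of `B` in the same fibre, and constant on `B` otherwise. -/
theorem exists_monotone_gap_counter {Y ι : Type*} [LinearOrder Y] (q : Y → ι)
    (hq : ∀ x y z, x ≤ y → y ≤ z → q x = q z → q y = q z) (B : Finset Y) (P : Finset ι)
    (hP : ∀ y ∈ B, q y ∈ P) :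
    ∃ n : Y → ℕ, Monotone n ∧ ∀ j, j + P.card < B.card →
      ∃ a ∈ B, ∃ b ∈ B, a < b ∧ q a = q b ∧ n a = j ∧ n b = j + 1 ∧ ∀ y < b, n y ≤ j := by
  classical
  set N := B.filter (fun x => ∃ x' ∈ B, x' < x ∧ q x' = q x) with hN
  have hNB : B.card ≤ N.card + P.card := by
    rw [← Finset.card_filter_add_card_filter_not (s := B)
      (fun x => ∃ x' ∈ B, x' < x ∧ q x' = q x)]
    refine Nat.add_le_add_left (Finset.card_le_card_of_injOn q ?_ ?_) _
    · intro y hy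
      exact hP y (Finset.mem_filter.1 hy).1
    · intro x hx y hy hxy
      have hx' := Finset.mem_filter.1 hx
      have hy' := Finset.mem_filter.1 hy
      rcases lt_trichotomy x y with h | h | h
      · exact absurd ⟨x, hx'.1, h, hxy⟩ hy'.2
      · exact h
      · exact absurd ⟨y, hy'.1, h, hxy.symm⟩ hx'.2
  set n : Y → ℕ := fun y => (N.filter (· ≤ y)).card with hn
  have hmono : Monotone n := fun x y hxy => Finset.card_le_card
    (Finset.monotone_filter_right N fun z _ hz => le_trans hz hxy)
  have hlt : ∀ b ∈ N, ∀ y < b, n y < n b := by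
    intro b hb y hy
    refine Finset.card_lt_card (Finset.ssubset_iff_subset_ne.2
      ⟨Finset.monotone_filter_right N fun z _ hz => le_trans hz hy.le, fun h => ?_⟩)
    have hmem : b ∈ N.filter (· ≤ b) := Finset.mem_filter.2 ⟨hb, le_rfl⟩
    rw [← h] at hmem
    exact absurd (Finset.mem_filter.1 hmem).2 (not_le.2 hy)
  have hsurj : Set.SurjOn n N (Finset.Icc 1 N.card) := by
    refine Finset.surjOn_of_injOn_of_card_le n ?_ ?_ (by simp)
    · intro b hb
      simp only [Finset.coe_Icc, Set.mem_Icc]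
      exact ⟨Finset.card_pos.2 ⟨b, Finset.mem_filter.2 ⟨hb, le_rfl⟩⟩,
        Finset.card_le_card (Finset.filter_subset _ _)⟩
    · intro x hx y hy hxy
      rcases lt_trichotomy x y with h | h | h
      · exact absurd hxy (hlt y hy x h).ne
      · exact h
      · exact absurd hxy (hlt x hx y h).ne'
  refine ⟨n, hmono, fun j hj => ?_⟩
  obtain ⟨b, hbN, hb⟩ := hsurj (show j + 1 ∈ (Finset.Icc 1 N.card : Set ℕ) by
    simp only [Finset.coe_Icc, Set.mem_Icc]; omega)
  have hbN' : b ∈ N := hbN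
  obtain ⟨hbB, x', hx'B, hx'b, hx'q⟩ := Finset.mem_filter.1 hbN'
  obtain ⟨a, ha, hmax⟩ := (B.filter (fun x => x < b ∧ q x = q b)).exists_max_image id
    ⟨x', Finset.mem_filter.2 ⟨hx'B, hx'b, hx'q⟩⟩
  obtain ⟨haB, hab, haq⟩ := Finset.mem_filter.1 ha
  have hle : ∀ y < b, n y ≤ j := fun y hy => by
    have := hlt b hbN' y hy
    omega
  refine ⟨a, haB, b, hbB, hab, haq, le_antisymm (hle a hab) ?_, hb, hle⟩
  have hsub : N.filter (· ≤ b) ⊆ insert b (N.filter (· ≤ a)) := by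
    intro x hx
    obtain ⟨hxN, hxb⟩ := Finset.mem_filter.1 hx
    rcases hxb.eq_or_lt with rfl | hxb'
    · exact Finset.mem_insert_self _ _
    refine Finset.mem_insert_of_mem (Finset.mem_filter.2 ⟨hxN, ?_⟩)
    by_contra! hax
    exact absurd (hmax x (Finset.mem_filter.2
      ⟨(Finset.mem_filter.1 hxN).1, hxb', hq a x b hax.le hxb haq⟩)) (not_le.2 hax)
  have := (Finset.card_le_card hsub).trans (Finset.card_insert_le _ _)
  change n b ≤ n a + 1 at this
  omega

/-- A map sending each point to the piece of the partition containing it. -/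
theorem IsIntervalPartition.exists_piece {𝒳 : Set ℝ} {P : Finset (Set ℝ)}
    (hP : IsIntervalPartition 𝒳 P) :
    ∃ q : ↥𝒳 → Set ℝ, (∀ y, q y ∈ P ∧ y.val ∈ q y) ∧ ∀ y, ∀ J ∈ P, y.val ∈ J → J = q y := by
  choose q hq using fun y : ↥𝒳 => hP.2 y.val y.2
  exact ⟨q, fun y => (hq y).1, fun y J hJ hy => (hq y).2 J ⟨hJ, hy⟩⟩

/-- The superlevel sets of `k`-piecewise monotone functions over a `K`-piecewise constant one
have VC-dimension at most `2k + K - 1`. -/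
theorem PiecewiseConst.vcDimLE_superlevel {𝒳 : Set ℝ} {K : ℕ} {fbar : ℝ → ℝ}
    (h : PiecewiseConst 𝒳 K fbar) (k : ℕ) :
    VCDimLE {S : Set ↥𝒳 | ∃ f, PiecewiseMono 𝒳 k f ∧ S = {y | fbar y.val < f y.val}}
      (2 * k + K - 1) := by
  obtain ⟨P, hPK, hP, hPc⟩ := h
  obtain ⟨q, hq, hq'⟩ := hP.exists_piece
  intro B hB
  obtain ⟨n, hmono, hgap⟩ := exists_monotone_gap_counter q
    (fun x y z hxy hyz hxz => (hq' y (q z) (hq z).1 ((hP.1 _ (hq z).1).1.out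
      (hxz ▸ (hq x).2) (hq z).2 ⟨hxy, hyz⟩)).symm) B P (fun y _ => (hq y).1)
  refine ⟨{y | y ∈ B ∧ Even (n y)}, fun y hy => hy.1, ?_⟩
  rintro A ⟨f, ⟨Q, hQk, hQ, hQm⟩, rfl⟩ hC
  have hiff : ∀ y ∈ B, (fbar y.val < f y.val ↔ Even (n y)) := fun y hy => by
    have := Set.ext_iff.1 hC y
    simpa [hy] using this
  have hconst : ∀ a b, q a = q b → fbar a.val = fbar b.val := fun a b hab => by
    obtain ⟨c, hc⟩ := hPc _ (hq b).1
    rw [hc _ (hq b).2, hc _ (hab ▸ (hq a).2)]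
  obtain ⟨r, hr, -⟩ := hQ.exists_piece
  have hgap' : ∀ j : Fin (2 * k), ∃ a ∈ B, ∃ b ∈ B, a < b ∧ q a = q b ∧ n a = j ∧ n b = j + 1 ∧
      ∀ y < b, n y ≤ j := fun j => hgap j (by have := j.2; omega)
  choose a haB b hbB hab hqab hna hnb hlt using hgap'
  have hBne : B.Nonempty := Finset.card_pos.1 (by omega)
  have hsep : ∃ p : Fin (k + 1) → ↥𝒳, ∀ i : Fin (k + 1), ∀ m (hm : m < k), i.val ≤ m →
      p i ≤ a ⟨2 * m, by omega⟩ ∧ p ⟨m + 1, by omega⟩ = b ⟨2 * m + 1, by omega⟩ := by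
    refine ⟨fun i => if h : i.val = 0 then B.min' hBne else b ⟨2 * i.val - 1, by omega⟩, ?_⟩
    intro i m hm him
    refine ⟨?_, ?_⟩
    · dsimp only
      split_ifs with h
      · exact B.min'_le _ (haB _)
      · by_contra! hlt'
        have h1 := hlt _ _ hlt'
        rw [hna] at h1
        simp only at h1
        omega
    · simp only [Nat.add_eq_zero_iff, one_ne_zero, and_false, dite_false]
      congr 1
  obtain ⟨p, hp⟩ := hsep
  have hne : ∀ i j : Fin (k + 1), i < j → r (p i) ≠ r (p j) := by
    intro i j hij hrij
    obtain ⟨m, hm⟩ : ∃ m, j.val = m + 1 := ⟨j.val - 1, by have : i.val < j.val := hij; omega⟩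
    have hmk : m < k := by omega
    obtain ⟨h1, h2⟩ := hp i m hmk (by have : i.val < j.val := hij; omega)
    have hj : j = ⟨m + 1, by omega⟩ := Fin.ext hm
    rw [← hj] at h2
    set j₀ : Fin (2 * k) := ⟨2 * m, by omega⟩ with hj₀
    set j₁ : Fin (2 * k) := ⟨2 * m + 1, by omega⟩ with hj₁
    have h01 : b j₀ ≤ a j₁ := by
      by_contra! hlt'
      have h3 := hlt _ _ hlt'
      rw [hna] at h3
      simp only [hj₀, hj₁] at h3
      omega
    have hmem : ∀ y, p i ≤ y → y ≤ p j → y.val ∈ r (p j) := fun y hy hy' =>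
      (hQ.1 _ (hr (p j)).1).1.out (hrij ▸ (hr (p i)).2) (hr (p j)).2 ⟨hy, hy'⟩
    have ha₀ := hmem (a j₀) h1 (h2 ▸ ((hab j₀).le.trans (h01.trans (hab j₁).le)))
    have hb₀ := hmem (b j₀) (h1.trans (hab j₀).le) (h2 ▸ (h01.trans (hab j₁).le))
    have ha₁ := hmem (a j₁) (h1.trans ((hab j₀).le.trans h01)) (h2 ▸ (hab j₁).le)
    have hb₁ := hmem (b j₁) (h1.trans ((hab j₀).le.trans (h01.trans (hab j₁).le))) h2.ge
    have ea₀ : fbar (a j₀).val < f (a j₀).val :=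
      (hiff _ (haB _)).2 (by rw [hna]; exact even_two_mul m)
    have eb₀ : ¬ fbar (b j₀).val < f (b j₀).val := fun h =>
      absurd ((hiff _ (hbB _)).1 h) (by rw [hnb]; simp [hj₀, parity_simps])
    have ea₁ : ¬ fbar (a j₁).val < f (a j₁).val := fun h =>
      absurd ((hiff _ (haB _)).1 h) (by rw [hna]; simp [hj₁, parity_simps])
    have eb₁ : fbar (b j₁).val < f (b j₁).val :=
      (hiff _ (hbB _)).2 (by rw [hnb]; simp [hj₁, parity_simps])
    have e₀ := hconst _ _ (hqab j₀)
    have e₁ := hconst _ _ (hqab j₁)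
    rcases hQm _ (hr (p j)).1 with hf | hf
    · have := hf ha₀ hb₀ (hab j₀).le
      linarith
    · have := hf ha₁ hb₁ (hab j₁).le
      linarith
  obtain ⟨i, -, j, -, hij, hrij⟩ := Finset.exists_ne_map_eq_of_card_lt_of_maps_to
    (s := (Finset.univ : Finset (Fin (k + 1)))) (t := Q) (f := fun i => r (p i))
    (by simp only [Finset.card_univ, Fintype.card_fin]; omega) (fun i _ => (hr (p i)).1)
  rcases lt_or_gt_of_ne hij with h | h
  · exact hne i j h hrij
  · exact hne j i h hrij.symm

theorem PiecewiseMono.neg {𝒳 : Set ℝ} {k : ℕ} {f : ℝ → ℝ} (h : PiecewiseMono 𝒳 k f) :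
    PiecewiseMono 𝒳 k (-f) := by
  obtain ⟨P, hk, hP, hf⟩ := h
  exact ⟨P, hk, hP, fun J hJ => (hf J hJ).symm.imp AntitoneOn.neg MonotoneOn.neg⟩

theorem PiecewiseConst.neg {𝒳 : Set ℝ} {K : ℕ} {f : ℝ → ℝ} (h : PiecewiseConst 𝒳 K f) :
    PiecewiseConst 𝒳 K (-f) := by
  obtain ⟨P, hK, hP, hf⟩ := h
  refine ⟨P, hK, hP, fun J hJ => ?_⟩
  obtain ⟨c, hc⟩ := hf J hJ
  exact ⟨-c, fun y hy => congrArg Neg.neg (hc y hy)⟩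

theorem VCDimLE.mono {Y : Type*} {𝒜 ℬ : Set (Set Y)} {D : ℕ} (h : VCDimLE ℬ D) (hsub : 𝒜 ⊆ ℬ) :
    VCDimLE 𝒜 D := fun B hB =>
  let ⟨C, hCB, hC⟩ := h B hB
  ⟨C, hCB, fun A hA => hC A (hsub hA)⟩

/-- Proposition 2: a function on the nontrivial interval `𝒳` which is
both `k`-piecewise monotone and `K`-piecewise constant is extremal in the class `M_k`
of `k`-piecewise monotone functions on `𝒳`, with degree not larger than `2k + K − 1`. -/
theorem stmt3 (𝒳 : Set ℝ) (h𝒳 : 𝒳.OrdConnected) (h𝒳nt : 𝒳.Nontrivial)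
    (k K : ℕ) (hk : 1 ≤ k) (hK : 1 ≤ K) (fbar : ℝ → ℝ)
    (h1 : PiecewiseMono 𝒳 k fbar) (h2 : PiecewiseConst 𝒳 K fbar) :
    ExtremalDegLE {g : ↥𝒳 → ℝ | ∃ f : ℝ → ℝ, PiecewiseMono 𝒳 k f ∧ g = fun y => f y.val}
      (fun y => fbar y.val) (2 * k + K - 1) := by
  constructor
  · refine (h2.vcDimLE_superlevel k).mono ?_
    rintro _ ⟨_, ⟨f, hf, rfl⟩, rfl⟩
    exact ⟨f, hf, rfl⟩
  · refine (h2.neg.vcDimLE_superlevel k).mono ?_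
    rintro _ ⟨_, ⟨f, hf, rfl⟩, rfl⟩
    exact ⟨-f, hf.neg, by simp⟩
end

section
/- Let 𝒳 be a nontrivial interval of ℝ, x_1 ≤ … ≤ x_n points of 𝒳, and f ∈ M_k monotone on each element of a partition 𝒥 of 𝒳 into at most k nontrivial intervals. For every γ > 0 there exists a function f̄ that is both k-piecewise monotone and ⌊k+γ⌋-piecewise constant on 𝒳 such that (1/n)·Σ_{i=1}^n |f(x_i) − f̄(x_i)| ≤ V_𝒥(x,f)/γ. -/
open scoped ENNReal
attribute [local instance] Classical.propDecidable

/-- The number of design points falling in `J`. -/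
noncomputable def nPts {n : ℕ} (x : Fin n → ℝ) (J : Set ℝ) : ℕ :=
  (Finset.univ.filter fun i => x i ∈ J).card

/-- The variation `V_J(f) = sup_J f − inf_J f` of `f` on `J`, with values in `[0,∞]`. -/
noncomputable def varOn (f : ℝ → ℝ) (J : Set ℝ) : ℝ≥0∞ :=
  ⨆ u ∈ J, ⨆ v ∈ J, ENNReal.ofReal (f u - f v)

/-- The `𝒥`-variation `V_𝒥(x,f) = (∑_{J∈𝒥} √(n_J·V_J(f)/n))²`, with values in `[0,∞]`. -/
noncomputable def Jvariation {n : ℕ} (x : Fin n → ℝ) (P : Finset (Set ℝ)) (f : ℝ → ℝ) :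
    ℝ≥0∞ :=
  (∑ J ∈ P, ((nPts x J * varOn f J) / n) ^ ((1 : ℝ) / 2)) ^ (2 : ℝ)

lemma exists_monotone_retraction {J : Set ℝ} (hJ : J.OrdConnected) (hJn : J.Nontrivial)
    {S : Finset ℝ} (hS : S.Nonempty) (hSJ : ↑S ⊆ J) :
    ∃ N : ℝ → ℝ, Monotone N ∧ (∀ u, N u ∈ S) ∧ (∀ s ∈ S, N s = s) ∧
      ∀ s ∈ S, ∃ u ∈ J, u ≠ s ∧ N u = s := by
  choose N hNS hN using fun u : ℝ => S.exists_min_image (fun s => |u - s|) hS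
  refine ⟨N, ?_, hNS, ?_, ?_⟩
  · intro u v huv
    by_contra! hlt
    have h₁ := hN u _ (hNS v)
    have h₂ := hN v _ (hNS u)
    have huv' : u ≠ v := by
      rintro rfl
      exact lt_irrefl _ hlt
    have h₃ : u < v := lt_of_le_of_ne huv huv'
    grind
  · intro s hs
    have h := hN s s hs
    grind
  · intro s hs
    have hacc : AccPt s (Filter.principal J) :=
      hJ.isPreconnected.preperfect_of_nontrivial hJn s (hSJ hs)
    have hev : ∀ᶠ u in nhds s, ∀ t ∈ S, t ≠ s → |u - s| < |u - t| := by
      rw [Filter.eventually_all_finset]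
      intro t _
      by_cases hts : t = s
      · simp [hts]
      · have hc₁ : Filter.Tendsto (fun u : ℝ => |u - s|) (nhds s) (nhds |s - s|) :=
          Continuous.tendsto (by fun_prop) s
        have hc₂ : Filter.Tendsto (fun u : ℝ => |u - t|) (nhds s) (nhds |s - t|) :=
          Continuous.tendsto (by fun_prop) s
        have hlt : |s - s| < |s - t| := by
          simpa [sub_eq_zero] using Ne.symm hts
        filter_upwards [hc₁.eventually_lt hc₂ hlt] with u hu _ using hu
    obtain ⟨u, ⟨hu, huJ⟩, hus⟩ := accPt_iff_nhds.mp hacc _ hev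
    refine ⟨u, huJ, hus, ?_⟩
    by_contra hne
    exact (hu _ (hNS u) hne).not_ge (hN u s hs)

lemma exists_monotone_quantizer (m : ℝ) {D : ℝ} (hD : 0 ≤ D) {K : ℕ} (hK : 1 ≤ K) :
    ∃ (c : ℝ → ℝ) (T : Finset ℝ), Monotone c ∧ T.card ≤ K ∧ (∀ t, c t ∈ T) ∧
      ∀ t, m ≤ t → t ≤ m + D → |t - c t| ≤ D / K := by
  have hK₀ : (0 : ℝ) < K := by exact_mod_cast hK
  set q : ℝ → ℕ := fun t => min ⌊(t - m) * K / D⌋₊ (K - 1) with hq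
  refine ⟨fun t => m + q t * (D / K), (Finset.range K).image fun j : ℕ => m + j * (D / K),
    ?_, ?_, ?_, ?_⟩
  · intro s t hst
    have : q s ≤ q t := by
      simp only [hq]
      gcongr
    have : (q s : ℝ) ≤ q t := by exact_mod_cast this
    have := mul_le_mul_of_nonneg_right this (div_nonneg hD hK₀.le)
    simpa using this
  · exact Finset.card_image_le.trans (by simp)
  · intro t
    refine Finset.mem_image_of_mem _ (Finset.mem_range.mpr ?_)
    have : q t ≤ K - 1 := min_le_right _ _
    omega
  · intro t h₁ h₂
    rcases hD.eq_or_lt with rfl | hD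
    · have : t = m := by linarith
      simp [this]
    set z := (t - m) * K / D with hz
    have hz₀ : 0 ≤ z := by
      have : 0 ≤ t - m := by linarith
      positivity
    have hzK : z ≤ K := by
      rw [hz, div_le_iff₀ hD]
      nlinarith
    have htz : t = m + z * (D / K) := by
      rw [hz]
      field_simp
      ring
    have hqz : (q t : ℝ) ≤ z :=
      (Nat.cast_le.mpr (min_le_left _ _)).trans (Nat.floor_le hz₀)
    have hzq : z ≤ q t + 1 := by
      rcases min_choice ⌊z⌋₊ (K - 1) with h | h
      · have : q t = ⌊z⌋₊ := h
        rw [this]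
        exact (Nat.lt_floor_add_one z).le
      · have : q t = K - 1 := h
        rw [this, Nat.cast_sub hK]
        simpa using hzK
    have hDK : 0 < D / K := by positivity
    have heq : t - (m + q t * (D / K)) = (z - q t) * (D / K) := by
      nth_rewrite 1 [htz]
      ring
    rw [heq, abs_of_nonneg (mul_nonneg (by linarith) hDK.le)]
    nlinarith

lemma IsIntervalPartition.singleton {J : Set ℝ} (hJ : J.OrdConnected) (hJn : J.Nontrivial) :
    IsIntervalPartition J {J} := by
  refine ⟨by simp [hJ, hJn], fun y hy => ⟨J, by simp [hy], by simp⟩⟩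

lemma exists_step_approx_on_piece {J : Set ℝ} (hJ : J.OrdConnected) (hJn : J.Nontrivial)
    {S : Finset ℝ} (hSJ : ↑S ⊆ J) {f : ℝ → ℝ} (hf : MonotoneOn f J ∨ AntitoneOn f J)
    {D : ℝ} (hfD : ∀ s ∈ S, ∀ t ∈ S, f s - f t ≤ D) {K : ℕ} (hK : 1 ≤ K) :
    ∃ g : ℝ → ℝ, (MonotoneOn g J ∨ AntitoneOn g J) ∧ PiecewiseConst J K g ∧
      ∀ s ∈ S, |f s - g s| ≤ D / K := by
  rcases S.eq_empty_or_nonempty with rfl | hS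
  · exact ⟨fun _ => 0, Or.inl fun _ _ _ _ _ => le_rfl,
      ⟨{J}, by simpa using hK, .singleton hJ hJn, fun _ _ => ⟨0, fun _ _ => rfl⟩⟩, by simp⟩
  obtain ⟨s₀, hs₀, hmin⟩ := S.exists_min_image f hS
  have hD : 0 ≤ D := by simpa using hfD s₀ hs₀ s₀ hs₀
  obtain ⟨N, hNmono, hNS, hNid, hNnt⟩ := exists_monotone_retraction hJ hJn hS hSJ
  obtain ⟨c, T, hcmono, hTcard, hcT, hc⟩ := exists_monotone_quantizer (f s₀) hD hK
  set g : ℝ → ℝ := fun u => c (f (N u)) with hg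
  have hNJ : ∀ u, N u ∈ J := fun u => hSJ (hNS u)
  have hgmono : MonotoneOn g J ∨ AntitoneOn g J := hf.imp
    (fun h u _ v _ huv => hcmono (h (hNJ u) (hNJ v) (hNmono huv)))
    (fun h u _ v _ huv => hcmono (h (hNJ u) (hNJ v) (hNmono huv)))
  refine ⟨g, hgmono, ?_, ?_⟩
  · refine ⟨(T.image fun t => {u ∈ J | g u = t}).filter Set.Nonempty,
      (Finset.card_filter_le _ _).trans (Finset.card_image_le.trans hTcard), ⟨?_, ?_⟩, ?_⟩
    · intro A hA
      simp only [Finset.mem_filter, Finset.mem_image] at hA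
      obtain ⟨⟨t, -, rfl⟩, v, hvJ, hv⟩ := hA
      refine ⟨⟨?_⟩, ?_, Set.sep_subset _ _⟩
      · rintro a ⟨haJ, ha⟩ b ⟨hbJ, hb⟩ w hw
        have hwJ : w ∈ J := hJ.out haJ hbJ hw
        refine ⟨hwJ, ?_⟩
        rcases hgmono with h | h
        · exact le_antisymm (hb ▸ h hwJ hbJ hw.2) (ha ▸ h haJ hwJ hw.1)
        · exact le_antisymm (ha ▸ h haJ hwJ hw.1) (hb ▸ h hwJ hbJ hw.2)
      · obtain ⟨u, huJ, hu, hNu⟩ := hNnt (N v) (hNS v)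
        refine ⟨u, ⟨huJ, ?_⟩, N v, ⟨hNJ v, ?_⟩, hu⟩
        · simpa [hg, hNu] using hv
        · simpa [hg, hNid _ (hNS v)] using hv
    · intro y hy
      refine ⟨{u ∈ J | g u = g y}, ⟨?_, hy, rfl⟩, ?_⟩
      · simp only [Finset.mem_filter, Finset.mem_image]
        exact ⟨⟨g y, hcT _, rfl⟩, y, hy, rfl⟩
      · rintro A ⟨hA, hyA⟩
        simp only [Finset.mem_filter, Finset.mem_image] at hA
        obtain ⟨⟨t, -, rfl⟩, -⟩ := hA
        rw [hyA.2]
    · intro A hA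
      simp only [Finset.mem_filter, Finset.mem_image] at hA
      obtain ⟨⟨t, -, rfl⟩, -⟩ := hA
      exact ⟨t, fun y hy => hy.2⟩
  · intro s hs
    simp only [hg, hNid s hs]
    exact hc _ (hmin s hs) (by linarith [hfD s hs s₀ hs₀])

lemma PiecewiseConst.glue {𝒳 : Set ℝ} {P : Finset (Set ℝ)} (hP : IsIntervalPartition 𝒳 P)
    {K : Set ℝ → ℕ} {h : ℝ → ℝ} (hh : ∀ J ∈ P, PiecewiseConst J (K J) h) :
    PiecewiseConst 𝒳 (∑ J ∈ P, K J) h := by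
  choose! Q hQcard hQ hQc using hh
  refine ⟨P.biUnion Q, Finset.card_biUnion_le.trans (Finset.sum_le_sum hQcard), ⟨?_, ?_⟩, ?_⟩
  · intro A hA
    obtain ⟨J, hJ, hA⟩ := Finset.mem_biUnion.mp hA
    obtain ⟨h₁, h₂, h₃⟩ := (hQ J hJ).1 A hA
    exact ⟨h₁, h₂, h₃.trans (hP.1 J hJ).2.2⟩
  · intro y hy
    obtain ⟨J, ⟨hJ, hyJ⟩, hJu⟩ := hP.2 y hy
    obtain ⟨A, ⟨hA, hyA⟩, hAu⟩ := (hQ J hJ).2 y hyJ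
    refine ⟨A, ⟨Finset.mem_biUnion.mpr ⟨J, hJ, hA⟩, hyA⟩, ?_⟩
    rintro B ⟨hB, hyB⟩
    obtain ⟨J', hJ', hB⟩ := Finset.mem_biUnion.mp hB
    obtain rfl : J' = J := hJu J' ⟨hJ', ((hQ J' hJ').1 B hB).2.2 hyB⟩
    exact hAu B ⟨hB, hyB⟩
  · intro A hA
    obtain ⟨J, hJ, hA⟩ := Finset.mem_biUnion.mp hA
    exact hQc J hJ A hA

lemma PiecewiseConst.mono {𝒳 : Set ℝ} {K L : ℕ} (hKL : K ≤ L) {f : ℝ → ℝ}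
    (hf : PiecewiseConst 𝒳 K f) : PiecewiseConst 𝒳 L f :=
  let ⟨P, hPK, hP⟩ := hf
  ⟨P, hPK.trans hKL, hP⟩

lemma PiecewiseConst.congr {𝒳 : Set ℝ} {K : ℕ} {f g : ℝ → ℝ} (hfg : Set.EqOn g f 𝒳)
    (hf : PiecewiseConst 𝒳 K f) : PiecewiseConst 𝒳 K g := by
  obtain ⟨P, hPK, hP, hc⟩ := hf
  refine ⟨P, hPK, hP, fun J hJ => (hc J hJ).imp fun c h y hy => ?_⟩
  rw [hfg ((hP.1 J hJ).2.2 hy), h y hy]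

lemma IsIntervalPartition.exists_eqOn {𝒳 : Set ℝ} {P : Finset (Set ℝ)}
    (hP : IsIntervalPartition 𝒳 P) (g : Set ℝ → ℝ → ℝ) :
    ∃ h : ℝ → ℝ, ∀ J ∈ P, Set.EqOn h (g J) J := by
  choose! p hp hpu using hP.2
  refine ⟨fun u => g (p u) u, fun J hJ u hu => ?_⟩
  change g (p u) u = g J u
  rw [hpu u ((hP.1 J hJ).2.2 hu) J ⟨hJ, hu⟩]

lemma exists_oscillation_le_varOn (f : ℝ → ℝ) {J : Set ℝ} {S : Finset ℝ} (hSJ : ↑S ⊆ J) :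
    ∃ D : ℝ, 0 ≤ D ∧ (∀ s ∈ S, ∀ t ∈ S, f s - f t ≤ D) ∧ ENNReal.ofReal D ≤ varOn f J := by
  rcases S.eq_empty_or_nonempty with rfl | hS
  · exact ⟨0, le_rfl, by simp, by simp⟩
  obtain ⟨a, ha, hmin⟩ := S.exists_min_image f hS
  obtain ⟨b, hb, hmax⟩ := S.exists_max_image f hS
  refine ⟨f b - f a, by linarith [hmin b hb], fun s hs t ht => ?_, ?_⟩
  · linarith [hmax s hs, hmin t ht]
  · exact le_iSup₂_of_le b (hSJ hb) (le_iSup₂_of_le a (hSJ ha) le_rfl)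

/-- Allocating integers to the weights `r j` in proportion to their size. -/
lemma exists_allocation {ι : Type*} (P : Finset ι) (r : ι → ℝ) (hr : ∀ j, 0 ≤ r j)
    {γ : ℝ} (hγ : 0 < γ) :
    ∃ K : ι → ℕ, (∀ j, 1 ≤ K j) ∧ ((∑ j ∈ P, K j : ℕ) : ℝ) ≤ P.card + γ ∧
      ∑ j ∈ P, r j ^ 2 / K j ≤ (∑ j ∈ P, r j) ^ 2 / γ := by
  set R := ∑ j ∈ P, r j with hR
  have hR₀ : 0 ≤ R := Finset.sum_nonneg fun j _ => hr j
  refine ⟨fun j => ⌊γ * r j / R⌋₊ + 1, fun j => by simp, ?_, ?_⟩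
  · have hle : ∑ j ∈ P, (⌊γ * r j / R⌋₊ : ℝ) ≤ ∑ j ∈ P, γ * r j / R :=
      Finset.sum_le_sum fun j _ =>
        Nat.floor_le (div_nonneg (mul_nonneg hγ.le (hr j)) hR₀)
    have hsum : ∑ j ∈ P, γ * r j / R ≤ γ := by
      rw [← Finset.sum_div, ← Finset.mul_sum, ← hR]
      exact div_le_of_le_mul₀ hR₀ hγ.le le_rfl
    push_cast
    rw [Finset.sum_add_distrib]
    simp only [Finset.sum_const, nsmul_eq_mul, mul_one]
    linarith
  · rw [sq R, mul_div_assoc, hR, Finset.sum_mul, ← hR]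
    refine Finset.sum_le_sum fun j hj => ?_
    have hK : (0 : ℝ) < ((⌊γ * r j / R⌋₊ + 1 : ℕ) : ℝ) := by positivity
    rw [← mul_div_assoc, div_le_div_iff₀ hK hγ]
    have hjR : r j ≤ R := Finset.single_le_sum (fun i _ => hr i) hj
    rcases hR₀.eq_or_lt with h₀ | h₀
    · have : r j = 0 := le_antisymm (h₀ ▸ hjR) (hr j)
      simp [this]
    · have h := (Nat.lt_floor_add_one (γ * r j / R)).le
      rw [div_le_iff₀ h₀] at h
      push_cast
      nlinarith [mul_le_mul_of_nonneg_left h (hr j)]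

lemma sum_abs_le_sum_nPts {n : ℕ} {x : Fin n → ℝ} {P : Finset (Set ℝ)} {e : ℝ → ℝ}
    {B : Set ℝ → ℝ} (hB : ∀ J ∈ P, 0 ≤ B J) (hx : ∀ i, ∃ J ∈ P, x i ∈ J)
    (he : ∀ J ∈ P, ∀ i, x i ∈ J → e (x i) ≤ B J) :
    ∑ i, e (x i) ≤ ∑ J ∈ P, nPts x J * B J := by
  have key : ∀ i, e (x i) ≤ ∑ J ∈ P, if x i ∈ J then B J else 0 := by
    intro i
    obtain ⟨J, hJ, hi⟩ := hx i
    refine (he J hJ i hi).trans ?_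
    refine le_trans ?_ (Finset.single_le_sum (fun J' hJ' => ?_) hJ)
    · simp [hi]
    · split_ifs
      exacts [hB J' hJ', le_rfl]
  refine (Finset.sum_le_sum fun i _ => key i).trans ?_
  rw [Finset.sum_comm]
  refine Finset.sum_le_sum fun J _ => ?_
  rw [← Finset.sum_filter]
  simp [nPts]

lemma ofReal_sq_sum_sqrt_le_Jvariation {n : ℕ} (hn : 0 < n) (x : Fin n → ℝ)
    (P : Finset (Set ℝ)) (f : ℝ → ℝ) {D : Set ℝ → ℝ} (hD : ∀ J ∈ P, 0 ≤ D J)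
    (hDv : ∀ J ∈ P, ENNReal.ofReal (D J) ≤ varOn f J) :
    ENNReal.ofReal ((∑ J ∈ P, √(nPts x J * D J / n)) ^ 2) ≤ Jvariation x P f := by
  have hn' : (0 : ℝ) < n := by exact_mod_cast hn
  rw [ENNReal.ofReal_pow (Finset.sum_nonneg fun _ _ => Real.sqrt_nonneg _), Jvariation,
    ENNReal.rpow_two, ENNReal.ofReal_sum_of_nonneg fun _ _ => Real.sqrt_nonneg _]
  gcongr with J hJ
  have hDJ := hD J hJ
  rw [Real.sqrt_eq_rpow, ← ENNReal.ofReal_rpow_of_nonneg (by positivity) (by norm_num),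
    ENNReal.ofReal_div_of_pos hn', ENNReal.ofReal_mul (Nat.cast_nonneg _),
    ENNReal.ofReal_natCast, ENNReal.ofReal_natCast]
  gcongr
  exact hDv J hJ

/-- Proposition 3: for `f ∈ M_k` monotone on each element of the
partition `𝒥` of the nontrivial interval `𝒳` into at most `k` nontrivial intervals,
and for every `γ > 0`, there is a function `fbar` which is both `k`-piecewise monotone
and `⌊k+γ⌋`-piecewise constant on `𝒳` such that
`(1/n)·∑ᵢ |f(xᵢ) − fbar(xᵢ)| ≤ V_𝒥(x,f)/γ`. -/
theorem stmt4 (𝒳 : Set ℝ) (h𝒳 : 𝒳.OrdConnected) (h𝒳nt : 𝒳.Nontrivial)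
    (n : ℕ) (hn : 0 < n) (x : Fin n → ℝ) (hxmem : ∀ i, x i ∈ 𝒳) (hxmono : Monotone x)
    (k : ℕ) (hk : 1 ≤ k) (f : ℝ → ℝ) (P : Finset (Set ℝ)) (hPcard : P.card ≤ k)
    (hP : IsIntervalPartition 𝒳 P) (hfmono : ∀ J ∈ P, MonotoneOn f J ∨ AntitoneOn f J)
    (γ : ℝ) (hγ : 0 < γ) :
    ∃ fbar : ℝ → ℝ, PiecewiseMono 𝒳 k fbar ∧
      PiecewiseConst 𝒳 (Nat.floor ((k : ℝ) + γ)) fbar ∧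
      ENNReal.ofReal ((∑ i, |f (x i) - fbar (x i)|) / n)
        ≤ Jvariation x P f / ENNReal.ofReal γ := by
  set S : Set ℝ → Finset ℝ := fun J => {y ∈ Finset.univ.image x | y ∈ J} with hS
  have hSJ : ∀ J, (S J : Set ℝ) ⊆ J := fun J y hy => (Finset.mem_filter.mp hy).2
  have hmemS : ∀ J i, x i ∈ J → x i ∈ S J := fun J i hi =>
    Finset.mem_filter.mpr ⟨Finset.mem_image_of_mem x (Finset.mem_univ i), hi⟩
  choose D hD₀ hfD hDv using fun J => exists_oscillation_le_varOn f (hSJ J)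
  have hn' : (0 : ℝ) < n := by exact_mod_cast hn
  obtain ⟨K, hK₁, hKsum, hK⟩ := exists_allocation P (fun J => √(nPts x J * D J / n))
    (fun _ => Real.sqrt_nonneg _) hγ
  have hpiece : ∀ J ∈ P, ∃ g : ℝ → ℝ, (MonotoneOn g J ∨ AntitoneOn g J) ∧
      PiecewiseConst J (K J) g ∧ ∀ s ∈ S J, |f s - g s| ≤ D J / K J := fun J hJ =>
    exists_step_approx_on_piece (hP.1 J hJ).1 (hP.1 J hJ).2.1 (hSJ J) (hfmono J hJ) (hfD J)
      (hK₁ J)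
  choose! g hgmono hgconst hg using hpiece
  obtain ⟨h, hh⟩ := hP.exists_eqOn g
  refine ⟨h, ⟨P, hPcard, hP, fun J hJ => (hgmono J hJ).imp (·.congr (hh J hJ).symm)
    (·.congr (hh J hJ).symm)⟩, ?_, ?_⟩
  · refine (PiecewiseConst.glue hP fun J hJ => (hgconst J hJ).congr (hh J hJ)).mono
      (Nat.le_floor (hKsum.trans ?_))
    gcongr
  · have herr : ∑ i, |f (x i) - h (x i)| ≤ ∑ J ∈ P, nPts x J * (D J / K J) :=
      sum_abs_le_sum_nPts (e := fun y => |f y - h y|)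
        (fun J _ => div_nonneg (hD₀ J) (Nat.cast_nonneg _))
        (fun i => (hP.2 _ (hxmem i)).exists)
        (fun J hJ i hi => by
          simpa only [hh J hJ hi] using hg J hJ _ (hmemS J i hi))
    have hreal : (∑ i, |f (x i) - h (x i)|) / n ≤
        (∑ J ∈ P, √(nPts x J * D J / n)) ^ 2 / γ := by
      refine le_trans ?_ hK
      rw [div_le_iff₀ hn', Finset.sum_mul]
      refine herr.trans (Finset.sum_le_sum fun J _ => le_of_eq ?_)
      have hDJ := hD₀ J
      rw [Real.sq_sqrt (by positivity)]
      field_simp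
    refine (ENNReal.ofReal_le_ofReal hreal).trans ?_
    rw [ENNReal.ofReal_div_of_pos hγ]
    gcongr
    exact ofReal_sq_sum_sqrt_le_Jvariation hn x P f (fun J _ => hD₀ J) fun J _ => hDv J
end

section
/- Let 𝒳 be a nontrivial compact interval of ℝ and k,K ≥ 1. If f̄ ∈ C_k is K-piecewise linear on 𝒳, then f̄ is extremal in C_k with degree not larger than 3k + 2(K−1). -/
/-- `P` is a partition of `𝒳` into (possibly trivial) intervals. -/
def IsIntervalPartition' (𝒳 : Set ℝ) (P : Finset (Set ℝ)) : Prop :=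
  (∀ J ∈ P, J.OrdConnected ∧ J ⊆ 𝒳) ∧
  ∀ y ∈ 𝒳, ∃! J, J ∈ P ∧ y ∈ J

/-- `f` is `k`-piecewise monotone-convex-concave on `𝒳`: it is continuous on `𝒳` and
there is a partition of `𝒳` into at most `k` nontrivial intervals on the closure of
each of which `f` is monotone and either convex or concave. -/
def PiecewiseMCC (𝒳 : Set ℝ) (k : ℕ) (f : ℝ → ℝ) : Prop :=
  ContinuousOn f 𝒳 ∧
  ∃ P : Finset (Set ℝ), P.card ≤ k ∧ IsIntervalPartition 𝒳 P ∧
    ∀ J ∈ P, (MonotoneOn f (closure J) ∨ AntitoneOn f (closure J)) ∧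
      (ConvexOn ℝ (closure J) f ∨ ConcaveOn ℝ (closure J) f)

/-- `f` is `K`-piecewise linear on `𝒳`: continuous on `𝒳` and affine on each element
of a partition of `𝒳` into at most `K` intervals. -/
def PiecewiseLinear (𝒳 : Set ℝ) (K : ℕ) (f : ℝ → ℝ) : Prop :=
  ContinuousOn f 𝒳 ∧
  ∃ P : Finset (Set ℝ), P.card ≤ K ∧ IsIntervalPartition' 𝒳 P ∧
    ∀ J ∈ P, ∃ a b : ℝ, ∀ y ∈ J, f y = a * y + b

/-- If equal values of `G` on `0, …, n - 1` form blocks, then the number of values on `0, …, m + 1`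
exceeds the one on `0, …, m` by one exactly when a block ends at `m`. -/
theorem card_image_range_add_two {γ : Type*} [DecidableEq γ] (G : ℕ → γ) (n : ℕ)
    (hG : ∀ i j l, i ≤ j → j ≤ l → l < n → G i = G l → G j = G l) (m : ℕ) (hm : m + 1 < n) :
    ((Finset.range (m + 2)).image G).card
      = ((Finset.range (m + 1)).image G).card + (if G m = G (m + 1) then 0 else 1) := by
  rw [Finset.range_add_one (n := m + 1), Finset.image_insert]
  split_ifs with h
  · rw [Finset.insert_eq_of_mem, add_zero]
    exact Finset.mem_image.2 ⟨m, by simp, h⟩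
  · refine Finset.card_insert_of_notMem fun hmem => ?_
    obtain ⟨i, hi, hi'⟩ := Finset.mem_image.1 hmem
    rw [Finset.mem_range] at hi
    exact h (hG i m (m + 1) (by omega) (by omega) hm hi')

/-- If equal values of `F` and `L` on `0, …, n - 1` form blocks, and three consecutive
indices in a common block must start with the parity prescribed by the value of `F`, then `n` is
bounded by the numbers of values of `F` and `L`. -/
theorem alternation_bound {α β : Type*} [DecidableEq α] [DecidableEq β]
    (F : ℕ → α) (L : ℕ → β) (c : α → Prop) (n : ℕ)
    (hF : ∀ i j l, i ≤ j → j ≤ l → l < n → F i = F l → F j = F l)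
    (hL : ∀ i j l, i ≤ j → j ≤ l → l < n → L i = L l → L j = L l)
    (H : ∀ i, i + 2 < n → F i = F (i + 1) → F (i + 1) = F (i + 2) →
      L i = L (i + 1) → L (i + 1) = L (i + 2) → (Even i ↔ c (F i)))
    (hn : 1 ≤ n) :
    n + 2 ≤ 3 * ((Finset.range n).image F).card + 2 * ((Finset.range n).image L).card := by
  have parity (i : ℕ) (hi : F i = F (i + 1)) :
      (Even (i + 1) ↔ c (F (i + 1))) ↔ ¬ (Even i ↔ c (F i)) := by
    rw [← hi, Nat.even_add_one, not_iff]
  have key : ∀ m, m < n →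
      m + 3 ≤ 3 * ((Finset.range (m + 1)).image F).card
        + 2 * ((Finset.range (m + 1)).image L).card ∧
      (¬ (Even m ↔ c (F m)) →
        m + 4 ≤ 3 * ((Finset.range (m + 1)).image F).card
          + 2 * ((Finset.range (m + 1)).image L).card) ∧
      ((Even m ↔ c (F m)) → (∀ j, j + 1 = m → F j = F m → L j ≠ L m) →
        m + 5 ≤ 3 * ((Finset.range (m + 1)).image F).card
          + 2 * ((Finset.range (m + 1)).image L).card) := by
    intro m
    induction m with
    | zero => intro _; simp
    | succ m ih =>
      intro hm
      obtain ⟨h0, h1, h2⟩ := ih (by omega)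
      rw [card_image_range_add_two F n hF m hm, card_image_range_add_two L n hL m hm]
      by_cases hFm : F m = F (m + 1)
      · have hpar := parity m hFm
        by_cases hLm : L m = L (m + 1)
        · have h3 (hs : Even m ↔ c (F m)) := h2 hs fun j hj hjF hjL => by
            subst hj
            exact (parity j hjF).1 hs (H j (by omega) hjF hFm hjL hLm)
          rw [if_pos hFm, if_pos hLm, hpar]
          refine ⟨?_, fun h => ?_, fun _ h => absurd hLm (h m rfl hFm)⟩
          · by_cases hs : Even m ↔ c (F m)
            · have := h3 hs; omega
            · have := h1 hs; omega
          · have := h3 (not_not.1 h); omega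
        · rw [if_pos hFm, if_neg hLm, hpar]
          refine ⟨by omega, fun _ => by omega, fun h _ => ?_⟩
          have := h1 h
          omega
      · rw [if_neg hFm]
        refine ⟨by omega, fun _ => by omega, fun _ _ => by omega⟩
  obtain ⟨m, rfl⟩ : ∃ m, n = m + 1 := ⟨n - 1, by omega⟩
  have := (key m (by omega)).1
  omega

/-- A class of sets on an interval has VC-dimension at most `3k + 2(K - 1)` if for each of its
sets `A` there are interval partitions `P`, `Q` of sizes at most `k`, `K` such that, for each
`J ∈ P`, either `A` or its complement is order-connected in `J ∩ I` for all `I ∈ Q`. -/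
theorem vcDimLE_of_partitions {X : Set ℝ} {k K : ℕ} (𝒜 : Set (Set X))
    (h : ∀ A ∈ 𝒜, ∃ P Q : Finset (Set ℝ), P.card ≤ k ∧ Q.card ≤ K ∧
      IsIntervalPartition' X P ∧ IsIntervalPartition' X Q ∧
      ∀ J ∈ P,
        (∀ I ∈ Q, ∀ x y z : X, x < y → y < z → x.1 ∈ J ∩ I → y.1 ∈ J ∩ I → z.1 ∈ J ∩ I →
          x ∉ A → z ∉ A → y ∉ A) ∨
        (∀ I ∈ Q, ∀ x y z : X, x < y → y < z → x.1 ∈ J ∩ I → y.1 ∈ J ∩ I → z.1 ∈ J ∩ I →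
          x ∈ A → z ∈ A → y ∈ A)) :
    VCDimLE 𝒜 (3 * k + 2 * (K - 1)) := by
  classical
  intro B hB
  have hn : 0 < B.card := by omega
  set n := B.card with hn'
  let e : ℕ → X := fun i => B.orderEmbOfFin rfl ⟨min i (n - 1), by omega⟩
  have he : ∀ i j, i < j → j < n → e i < e j := by
    intro i j hij hj
    refine (B.orderEmbOfFin rfl).strictMono ?_
    rw [Fin.mk_lt_mk]
    omega
  have heB : ∀ i, e i ∈ B := fun i => B.orderEmbOfFin_mem rfl _
  refine ⟨{y | ∃ i, i < n ∧ Even i ∧ e i = y}, ?_, fun A hA hC => ?_⟩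
  · rintro y ⟨i, -, -, rfl⟩
    exact heB i
  have hmem : ∀ i, i < n → (e i ∈ A ↔ Even i) := by
    intro i hi
    have hi' : e i ∈ (↑B ∩ A : Set X) ↔ ∃ j, j < n ∧ Even j ∧ e j = e i := by rw [hC]; rfl
    have hi'' : e i ∈ (↑B ∩ A : Set X) ↔ e i ∈ A := ⟨fun h => h.2, fun h => ⟨heB i, h⟩⟩
    rw [← hi'', hi']
    refine ⟨?_, fun h => ⟨i, hi, h, rfl⟩⟩
    rintro ⟨j, hj, hje, hji⟩
    rcases lt_trichotomy i j with hlt | rfl | hlt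
    · exact absurd hji (he i j hlt hj).ne'
    · exact hje
    · exact absurd hji (he j i hlt hi).ne
  obtain ⟨P, Q, hPk, hQK, hP, hQ, hPQ⟩ := h A hA
  have piece : ∀ R : Finset (Set ℝ), IsIntervalPartition' X R →
      ∃ F : ℕ → Set ℝ, (∀ i, F i ∈ R ∧ (e i).1 ∈ F i) ∧
        ∀ i j l, i ≤ j → j ≤ l → l < n → F i = F l → F j = F l := by
    intro R hR
    choose F hF _ using fun i => hR.2 (e i).1 (e i).2
    refine ⟨F, hF, fun i j l hij hjl hl hil => ?_⟩
    have hmono : ∀ i j, i ≤ j → j < n → (e i).1 ≤ (e j).1 := by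
      intro i j hij hj
      rcases hij.eq_or_lt with rfl | hlt
      · exact le_rfl
      · exact (he i j hlt hj).le
    have hj : (e j).1 ∈ F l :=
      (hR.1 _ (hF l).1).1.out (hil ▸ (hF i).2) (hF l).2
        ⟨hmono i j hij (by omega), hmono j l hjl hl⟩
    exact (hR.2 (e j).1 (e j).2).unique (hF j) ⟨(hF l).1, hj⟩
  obtain ⟨F, hF, hFc⟩ := piece P hP
  obtain ⟨L, hL, hLc⟩ := piece Q hQ
  have bound := alternation_bound F L
    (fun J => ∀ I ∈ Q, ∀ x y z : X, x < y → y < z → x.1 ∈ J ∩ I → y.1 ∈ J ∩ I → z.1 ∈ J ∩ I →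
      x ∉ A → z ∉ A → y ∉ A) n hFc hLc ?_ hn
  · have hFP : ((Finset.range n).image F).card ≤ P.card :=
      Finset.card_le_card (Finset.image_subset_iff.2 fun i _ => (hF i).1)
    have hLQ : ((Finset.range n).image L).card ≤ Q.card :=
      Finset.card_le_card (Finset.image_subset_iff.2 fun i _ => (hL i).1)
    omega
  · intro i hi hF0 hF1 hL0 hL1
    have m0 : (e i).1 ∈ F i ∩ L i := ⟨(hF i).2, (hL i).2⟩
    have m1 : (e (i + 1)).1 ∈ F i ∩ L i := by
      rw [hF0, hL0]; exact ⟨(hF _).2, (hL _).2⟩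
    have m2 : (e (i + 2)).1 ∈ F i ∩ L i := by
      rw [hF0, hL0, hF1, hL1]; exact ⟨(hF _).2, (hL _).2⟩
    have l0 := he i (i + 1) (by omega) (by omega)
    have l1 := he (i + 1) (i + 2) (by omega) hi
    have p0 := hmem i (by omega)
    have p1 := hmem (i + 1) (by omega)
    have p2 := hmem (i + 2) hi
    rw [Nat.even_add_one] at p1
    rw [show i + 2 = i + 1 + 1 from rfl, Nat.even_add_one, Nat.even_add_one] at p2
    constructor
    · intro hev
      refine (hPQ _ (hF i).1).resolve_right fun hc => ?_
      have := hc (L i) (hL i).1 _ _ _ l0 l1 m0 m1 m2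
      tauto
    · intro hc
      have := hc (L i) (hL i).1 _ _ _ l0 l1 m0 m1 m2
      tauto

/-- A convex function that lies weakly (strictly) below an affine one at two points does so at
each point between them. -/
theorem ConvexOn.le_and_lt_affine_of_mem_Ioo {s : Set ℝ} {f : ℝ → ℝ} (hf : ConvexOn ℝ s f)
    (p q : ℝ) {x y z : ℝ} (hx : x ∈ s) (hz : z ∈ s) (hxy : x < y) (hyz : y < z) :
    (f x ≤ p * x + q → f z ≤ p * z + q → f y ≤ p * y + q) ∧
    (f x < p * x + q → f z < p * z + q → f y < p * y + q) := by
  have h := hf.2 hx hz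
    (show 0 ≤ (z - y) / (z - x) by apply div_nonneg <;> linarith)
    (show 0 ≤ (y - x) / (z - x) by apply div_nonneg <;> linarith)
    (by rw [← add_div]; convert div_self (sub_ne_zero.2 (hxy.trans hyz).ne') using 2; ring)
  have hne : z - x ≠ 0 := sub_ne_zero.2 (hxy.trans hyz).ne'
  simp only [smul_eq_mul] at h
  rw [show (z - y) / (z - x) * x + (y - x) / (z - x) * z = y by field_simp; ring] at h
  have hu : 0 < (z - y) / (z - x) := by apply div_pos <;> linarith
  have hv : 0 < (y - x) / (z - x) := by apply div_pos <;> linarith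
  have hy : p * y + q = (z - y) / (z - x) * (p * x + q) + (y - x) / (z - x) * (p * z + q) := by
    field_simp; ring
  rw [hy]
  constructor <;> intro h1 h2
  · have := mul_le_mul_of_nonneg_left h1 hu.le
    have := mul_le_mul_of_nonneg_left h2 hv.le
    linarith
  · have := mul_lt_mul_of_pos_left h1 hu
    have := mul_lt_mul_of_pos_left h2 hv
    linarith

/-- A concave function that lies weakly (strictly) above an affine one at two points does so at
each point between them. -/
theorem ConcaveOn.affine_le_and_lt_of_mem_Ioo {s : Set ℝ} {f : ℝ → ℝ} (hf : ConcaveOn ℝ s f)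
    (p q : ℝ) {x y z : ℝ} (hx : x ∈ s) (hz : z ∈ s) (hxy : x < y) (hyz : y < z) :
    (p * x + q ≤ f x → p * z + q ≤ f z → p * y + q ≤ f y) ∧
    (p * x + q < f x → p * z + q < f z → p * y + q < f y) := by
  obtain ⟨h1, h2⟩ := hf.neg.le_and_lt_affine_of_mem_Ioo (-p) (-q) hx hz hxy hyz
  simp only [Pi.neg_apply] at h1 h2
  exact ⟨fun hx hz => by linarith [h1 (by linarith) (by linarith)],
    fun hx hz => by linarith [h2 (by linarith) (by linarith)]⟩

/-- Proposition 4: a function of `C_k` which is `K`-piecewise linear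
on the nontrivial compact interval `𝒳` is extremal in `C_k` with degree not larger than
`3k + 2(K−1)`. -/
theorem stmt6 (a b : ℝ) (hab : a < b) (k K : ℕ) (hk : 1 ≤ k) (hK : 1 ≤ K)
    (fbar : ℝ → ℝ) (h1 : PiecewiseMCC (Set.Icc a b) k fbar)
    (h2 : PiecewiseLinear (Set.Icc a b) K fbar) :
    ExtremalDegLE
      {g : ↥(Set.Icc a b) → ℝ |
        ∃ f : ℝ → ℝ, PiecewiseMCC (Set.Icc a b) k f ∧ g = fun y => f y.val}
      (fun y => fbar y.val) (3 * k + 2 * (K - 1)) := by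
  obtain ⟨-, Q, hQK, hQ, hQaff⟩ := h2
  constructor
  · refine vcDimLE_of_partitions _ ?_
    rintro _ ⟨_, ⟨f, ⟨-, P, hPk, hP, hPf⟩, rfl⟩, rfl⟩
    refine ⟨P, Q, hPk, hQK, ⟨fun J hJ => ⟨(hP.1 J hJ).1, (hP.1 J hJ).2.2⟩, hP.2⟩, hQ,
      fun J hJ => (hPf J hJ).2.imp ?_ ?_⟩ <;>
    · intro hf I hI x y z hxy hyz hx hy hz
      obtain ⟨p, q, hpq⟩ := hQaff I hI
      simp only [Set.mem_ofPred_eq, not_lt, hpq _ hx.2, hpq _ hy.2, hpq _ hz.2]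
      first
        | exact (hf.le_and_lt_affine_of_mem_Ioo p q (subset_closure hx.1) (subset_closure hz.1)
            hxy hyz).1
        | exact (hf.affine_le_and_lt_of_mem_Ioo p q (subset_closure hx.1) (subset_closure hz.1)
            hxy hyz).2
  · refine vcDimLE_of_partitions _ ?_
    rintro _ ⟨_, ⟨f, ⟨-, P, hPk, hP, hPf⟩, rfl⟩, rfl⟩
    refine ⟨P, Q, hPk, hQK, ⟨fun J hJ => ⟨(hP.1 J hJ).1, (hP.1 J hJ).2.2⟩, hP.2⟩, hQ,
      fun J hJ => (hPf J hJ).2.symm.imp ?_ ?_⟩ <;>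
    · intro hf I hI x y z hxy hyz hx hy hz
      obtain ⟨p, q, hpq⟩ := hQaff I hI
      simp only [Set.mem_ofPred_eq, not_lt, hpq _ hx.2, hpq _ hy.2, hpq _ hz.2]
      first
        | exact (hf.affine_le_and_lt_of_mem_Ioo p q (subset_closure hx.1) (subset_closure hz.1)
            hxy hyz).1
        | exact (hf.le_and_lt_affine_of_mem_Ioo p q (subset_closure hx.1) (subset_closure hz.1)
            hxy hyz).2
end

section
/- Let g be an increasing continuous function from a compact interval 𝒳 onto [0,1] admitting a concave modulus of continuity w̄ (i.e., |g(x) − g(y)| ≤ w̄(|x−y|) for all x,y ∈ 𝒳). If x_i = g^{-1}(i/n) for all i ∈ {1,…,n}, then the function w : u ↦ 1/n + w̄(u) is a modulus of the probability measure Q = (1/n)·Σ_{i=1}^n δ_{x_i}. -/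
open MeasureTheory
open scoped ENNReal

/-- `w` is a modulus of the Borel measure `μ` on `ℝ`. -/
def IsModulus (μ : Measure ℝ) (w : ℝ → ℝ) : Prop :=
  (∀ u, 0 ≤ u → 0 ≤ w u) ∧ MonotoneOn w (Set.Ici 0) ∧ ConcaveOn ℝ (Set.Ici 0) w ∧
  ∀ I : Set ℝ, I.OrdConnected → Bornology.IsBounded I →
    μ I ≤ ENNReal.ofReal (w (volume I).toReal)

/-- A set of indices in `Fin n` has at most `max - min + 1` elements. -/
theorem Finset.card_le_max'_sub_min'_add_one {n : ℕ} (S : Finset (Fin n)) (hS : S.Nonempty) :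
    S.card ≤ (S.max' hS : ℕ) - (S.min' hS : ℕ) + 1 := by
  have h : S ⊆ Finset.Icc (S.min' hS) (S.max' hS) := fun k hk =>
    Finset.mem_Icc.2 ⟨S.min'_le k hk, S.le_max' k hk⟩
  have h_card := Finset.card_le_card h
  rw [Fin.card_Icc] at h_card
  omega

/-- Two points of a bounded order-connected set are at distance at most its length. -/
theorem Set.OrdConnected.abs_sub_le_volume_toReal {I : Set ℝ} (hI : I.OrdConnected)
    (hb : Bornology.IsBounded I) {u v : ℝ} (hu : u ∈ I) (hv : v ∈ I) :
    |u - v| ≤ (volume I).toReal := by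
  have h := measure_mono (μ := volume) (hI.uIcc_subset hv hu)
  rw [Real.volume_interval] at h
  exact (ENNReal.ofReal_le_iff_le_toReal hb.measure_lt_top.ne).1 h

/-- The mass an empirical measure gives to a measurable set. -/
theorem smul_sum_dirac_apply {n : ℕ} (hn : 0 < n) (x : Fin n → ℝ) {I : Set ℝ}
    (hI : MeasurableSet I) [DecidablePred fun i => x i ∈ I] :
    ((n : ℝ≥0∞)⁻¹ • ∑ i, Measure.dirac (x i)) I =
      ENNReal.ofReal ((Finset.univ.filter fun i => x i ∈ I).card / (n : ℝ)) := by
  rw [ENNReal.ofReal_div_of_pos (by exact_mod_cast hn), ENNReal.ofReal_natCast,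
    ENNReal.ofReal_natCast, div_eq_mul_inv, mul_comm]
  simp [Measure.dirac_apply' _ hI, Set.indicator_apply]

/-- Proposition 6: if `g` is an increasing continuous function from
the compact interval `𝒳 = [a,b]` onto `[0,1]` with concave modulus of continuity `w̄`,
and `xᵢ = g⁻¹(i/n)` for `i ∈ {1,…,n}`, then `u ↦ 1/n + w̄(u)` is a modulus of the
empirical measure `Q = n⁻¹ ∑ᵢ δ_{xᵢ}`. -/
theorem stmt9 (a b : ℝ) (hab : a < b) (g : ℝ → ℝ)
    (hgmono : StrictMonoOn g (Set.Icc a b)) (hgcont : ContinuousOn g (Set.Icc a b))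
    (hgsurj : g '' Set.Icc a b = Set.Icc 0 1)
    (wbar : ℝ → ℝ) (hwpos : ∀ u, 0 ≤ u → 0 ≤ wbar u)
    (hwmono : MonotoneOn wbar (Set.Ici 0)) (hwconc : ConcaveOn ℝ (Set.Ici 0) wbar)
    (hwmod : ∀ u v, u ∈ Set.Icc a b → v ∈ Set.Icc a b → |g u - g v| ≤ wbar |u - v|)
    (n : ℕ) (hn : 0 < n) (x : Fin n → ℝ) (hx : ∀ i, x i ∈ Set.Icc a b)
    (hgx : ∀ i : Fin n, g (x i) = (((i : ℕ) : ℝ) + 1) / (n : ℝ)) :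
    IsModulus ((n : ℝ≥0∞)⁻¹ • ∑ i, Measure.dirac (x i))
      (fun u => 1 / (n : ℝ) + wbar u) := by
  classical
  refine ⟨fun u hu => add_nonneg (by positivity) (hwpos u hu),
    fun u hu v hv huv => by have := hwmono hu hv huv; simpa using this,
    (concaveOn_const _ (convex_Ici 0)).add hwconc, fun I hI hb => ?_⟩
  rw [smul_sum_dirac_apply hn x hI.measurableSet]
  apply ENNReal.ofReal_le_ofReal
  have hn' : (0 : ℝ) < n := by exact_mod_cast hn
  set S := Finset.univ.filter fun i => x i ∈ I with hSdef
  rcases S.eq_empty_or_nonempty with hS | hS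
  · rw [hS]
    have := hwpos _ (ENNReal.toReal_nonneg (a := volume I))
    simp only [Finset.card_empty, Nat.cast_zero, zero_div]
    positivity
  · have h_card := S.card_le_max'_sub_min'_add_one hS
    have h_le : (S.min' hS : ℕ) ≤ S.max' hS := S.min'_le _ (S.max'_mem hS)
    have hi := (Finset.mem_filter.1 (S.min'_mem hS)).2
    have hj := (Finset.mem_filter.1 (S.max'_mem hS)).2
    generalize S.min' hS = i at *
    generalize S.max' hS = j at *
    have h_mod := (le_abs_self _).trans (hwmod (x j) (x i) (hx j) (hx i))
    have h_mono := hwmono (abs_nonneg (x j - x i)) ENNReal.toReal_nonneg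
      (hI.abs_sub_le_volume_toReal hb hj hi)
    have h_real : (S.card : ℝ) ≤ (j : ℕ) - (i : ℕ) + 1 := by
      rw [← Nat.cast_sub h_le]
      exact_mod_cast h_card
    calc (S.card : ℝ) / n ≤ ((j : ℕ) - (i : ℕ) + 1) / n := by gcongr
      _ = 1 / n + (g (x j) - g (x i)) := by rw [hgx, hgx]; ring
      _ ≤ 1 / n + wbar (volume I).toReal := by linarith
end

section
/- Let Q be a probability measure on [a,b] with a < b, K a positive integer, and f a continuous, monotone, convex-or-concave function on [a,b]. If the variation of the derivatives |f'_r(a) − f'_l(b)| is finite, then there exists a K-linear interpolation f̄ of f on [a,b] such that ∫_{[a,b]} |f − f̄| dQ ≤ |f'_r(a) − f'_l(b)|·(b−a)/(4K²). -/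
open MeasureTheory Filter

/-- `l` is a `K`-linear interpolation of `f` on `[a,b]`: there is a subdivision
`a = t₀ < t₁ < … < t_K = b` such that `l` is affine on each `[t_{i−1}, t_i]` and
coincides with `f` at the points `t_i`. -/
def IsLinearInterp (f : ℝ → ℝ) (a b : ℝ) (K : ℕ) (l : ℝ → ℝ) : Prop :=
  ∃ t : Fin (K + 1) → ℝ, t 0 = a ∧ t (Fin.last K) = b ∧ StrictMono t ∧
    ∀ i : Fin K, ∀ y ∈ Set.Icc (t i.castSucc) (t i.succ),
      l y = f (t i.castSucc) +
        (f (t i.succ) - f (t i.castSucc)) / (t i.succ - t i.castSucc) * (y - t i.castSucc)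

/-- A convex function lies above its left tangent line at the right endpoint. -/
lemma ConvexOn.sub_le_of_tendsto_left {f : ℝ → ℝ} {a b q : ℝ} (hab : a < b)
    (hf : ConvexOn ℝ (Set.Icc a b) f)
    (hq : Tendsto (fun y => (f b - f y) / (b - y)) (nhdsWithin b (Set.Iio b)) (nhds q))
    {y : ℝ} (hy : y ∈ Set.Icc a b) : f b - f y ≤ q * (b - y) := by
  rcases eq_or_lt_of_le hy.2 with rfl | hyb
  · simp
  have h : (f b - f y) / (b - y) ≤ q := by
    refine ge_of_tendsto hq ?_
    filter_upwards [Ioo_mem_nhdsLT hyb] with z hz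
    have := hf.secant_mono (Set.right_mem_Icc.2 hab.le) hy ⟨hy.1.trans hz.1.le, hz.2.le⟩
      hyb.ne hz.2.ne hz.1.le
    rwa [← neg_div_neg_eq, neg_sub, neg_sub, ← neg_div_neg_eq (f z - f b), neg_sub, neg_sub] at this
  rwa [div_le_iff₀ (sub_pos.2 hyb)] at h

/-- A convex function lies above its right tangent line at the left endpoint. -/
lemma ConvexOn.le_sub_of_tendsto_right {f : ℝ → ℝ} {a b p : ℝ} (hab : a < b)
    (hf : ConvexOn ℝ (Set.Icc a b) f)
    (hp : Tendsto (fun y => (f y - f a) / (y - a)) (nhdsWithin a (Set.Ioi a)) (nhds p))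
    {y : ℝ} (hy : y ∈ Set.Icc a b) : p * (y - a) ≤ f y - f a := by
  rcases eq_or_lt_of_le hy.1 with rfl | hay
  · simp
  have h : p ≤ (f y - f a) / (y - a) := by
    refine le_of_tendsto hp ?_
    filter_upwards [Ioo_mem_nhdsGT hay] with z hz
    exact hf.secant_mono (Set.left_mem_Icc.2 hab.le) ⟨hz.1.le, hz.2.le.trans hy.2⟩ hy
      hz.1.ne' hay.ne' hz.2.le
  rwa [le_div_iff₀ (sub_pos.2 hay)] at h

/-- Error of the chord of a convex function, in terms of supporting slopes at the endpoints. -/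
lemma ConvexOn.abs_sub_chord_le {f : ℝ → ℝ} {a b p q : ℝ} (hab : a < b)
    (hf : ConvexOn ℝ (Set.Icc a b) f)
    (hp : ∀ y ∈ Set.Icc a b, p * (y - a) ≤ f y - f a)
    (hq : ∀ y ∈ Set.Icc a b, f b - f y ≤ q * (b - y)) {y : ℝ} (hy : y ∈ Set.Icc a b) :
    |f y - (f a + (f b - f a) / (b - a) * (y - a))| ≤ (q - p) * (b - a) / 4 := by
  have hL : 0 < b - a := sub_pos.2 hab
  obtain ⟨r, hr⟩ : ∃ r, r = (y - a) / (b - a) := ⟨_, rfl⟩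
  have hr0 : 0 ≤ r := hr ▸ div_nonneg (sub_nonneg.2 hy.1) hL.le
  have hr1 : r ≤ 1 := by rw [hr, div_le_one hL]; linarith [hy.2]
  have hya : y - a = r * (b - a) := by rw [hr]; field_simp
  have hby : b - y = (1 - r) * (b - a) := by linarith
  have hchord : f a + (f b - f a) / (b - a) * (y - a) = (1 - r) * f a + r * f b := by
    rw [hya]; field_simp; ring
  have hup : f y ≤ (1 - r) * f a + r * f b := by
    have := hf.2 (Set.left_mem_Icc.2 hab.le) (Set.right_mem_Icc.2 hab.le)
      (sub_nonneg.2 hr1) hr0 (by ring)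
    simp only [smul_eq_mul] at this
    rwa [show (1 - r) * a + r * b = y by linarith] at this
  have h1 := mul_le_mul_of_nonneg_left (hp y hy) (sub_nonneg.2 hr1)
  have h2 := mul_le_mul_of_nonneg_left (hq y hy) hr0
  have hpq : 0 ≤ (q - p) * (b - a) := by
    have := hp b (Set.right_mem_Icc.2 hab.le)
    have := hq a (Set.left_mem_Icc.2 hab.le)
    linarith
  have h3 := mul_nonneg hpq (sq_nonneg (2 * r - 1))
  rw [hya] at h1
  rw [hby] at h2
  rw [hchord, abs_of_nonpos (by linarith)]
  linarith

lemma exists_forall_sub_log_le {f : ℝ → ℝ} {a b p c : ℝ} (hab : a < b) (hc : 0 < c)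
    (hcont : ContinuousOn f (Set.Icc a b))
    (hp : ∀ y ∈ Set.Icc a b, p * (y - a) ≤ f y - f a) :
    ∃ t ∈ Set.Ioc a b, ∀ y ∈ Set.Ioc a b,
      f t - p * (t - a) - c * Real.log (t - a) ≤ f y - p * (y - a) - c * Real.log (y - a) := by
  set φ : ℝ → ℝ := fun y => f y - p * (y - a) - c * Real.log (y - a) with hφ
  set δ : ℝ := min (b - a) (Real.exp ((f a - φ b) / c)) with hδ
  have hδ0 : 0 < δ := lt_min (sub_pos.2 hab) (Real.exp_pos _)
  have hδL : a + δ ≤ b := by linarith [min_le_left (b - a) (Real.exp ((f a - φ b) / c))]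
  have hsub : Set.Icc (a + δ) b ⊆ Set.Icc a b := Set.Icc_subset_Icc_left (by linarith)
  have hφc : ContinuousOn φ (Set.Icc (a + δ) b) := by
    refine ((hcont.mono hsub).sub (by fun_prop)).sub (continuousOn_const.mul ?_)
    exact ContinuousOn.log (by fun_prop) fun y hy => by linarith [hy.1]
  obtain ⟨t, ht, hmin⟩ := isCompact_Icc.exists_isMinOn ⟨b, hδL, le_rfl⟩ hφc
  refine ⟨t, ⟨by linarith [ht.1], ht.2⟩, fun y hy => ?_⟩
  change φ t ≤ φ y
  rcases le_total (a + δ) y with h | h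
  · exact hmin ⟨h, hy.2⟩
  · refine (hmin ⟨hδL, le_rfl⟩ : φ t ≤ φ b).trans ?_
    have hlog : Real.log (y - a) ≤ (f a - φ b) / c := by
      rw [Real.log_le_iff_le_exp (sub_pos.2 hy.1)]
      exact le_trans (by linarith) (min_le_right _ _)
    rw [le_div_iff₀ hc] at hlog
    have := hp y ⟨hy.1.le, hy.2⟩
    simp only [hφ] at hlog ⊢
    linarith

/-- A minimizer of `f - p (· - a) - c log (· - a)` has the supporting slope `p + c / (t - a)`. -/
lemma ConvexOn.support_of_forall_sub_log_le {f : ℝ → ℝ} {a b p c t : ℝ} (hc : 0 < c)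
    (hf : ConvexOn ℝ (Set.Icc a b) f) (ht : t ∈ Set.Ioc a b)
    (hmin : ∀ y ∈ Set.Ioc a b,
      f t - p * (t - a) - c * Real.log (t - a) ≤ f y - p * (y - a) - c * Real.log (y - a))
    {y : ℝ} (hy : y ∈ Set.Icc a b) : (p + c / (t - a)) * (y - t) ≤ f y - f t := by
  have hta : 0 < t - a := sub_pos.2 ht.1
  obtain ⟨d, hd⟩ : ∃ d, d = (y - t) / (t - a) := ⟨_, rfl⟩
  have hd1 : -1 ≤ d := by rw [hd, le_div_iff₀ hta]; linarith [hy.1]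
  have hyt : y - t = d * (t - a) := by rw [hd]; field_simp
  have key : ∀ ε ∈ Set.Ioo (0 : ℝ) 1, p * (y - t) + c * (d / (1 + ε * d)) ≤ f y - f t := by
    rintro ε ⟨h0, h1⟩
    have hpos : 0 < 1 + ε * d := by nlinarith
    have hz : t + ε * (y - t) - a = (t - a) * (1 + ε * d) := by rw [hyt]; ring
    have hconv := hf.2 ⟨ht.1.le, ht.2⟩ hy (sub_nonneg.2 h1.le) h0.le (by ring)
    simp only [smul_eq_mul] at hconv
    rw [show (1 - ε) * t + ε * y = t + ε * (y - t) by ring] at hconv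
    have hm := hmin (t + ε * (y - t))
      ⟨by have := mul_pos hta hpos; linarith, by nlinarith [hy.2, ht.2]⟩
    rw [hz, Real.log_mul hta.ne' hpos.ne'] at hm
    have hlog := mul_le_mul_of_nonneg_left (Real.one_sub_inv_le_log_of_pos hpos) hc.le
    have he : 1 - (1 + ε * d)⁻¹ = ε * (d / (1 + ε * d)) := by field_simp; ring
    rw [he] at hlog
    refine le_of_mul_le_mul_left ?_ h0
    have : p * ((t - a) * (1 + ε * d)) = p * (t - a) + ε * (p * (y - t)) := by rw [hyt]; ring
    linarith
  have hlim : Tendsto (fun ε : ℝ => p * (y - t) + c * (d / (1 + ε * d)))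
      (nhdsWithin 0 (Set.Ioi 0)) (nhds (p * (y - t) + c * (d / (1 + 0 * d)))) := by
    have : ContinuousAt (fun ε : ℝ => p * (y - t) + c * (d / (1 + ε * d))) 0 := by
      fun_prop (disch := simp)
    exact this.tendsto.mono_left nhdsWithin_le_nhds
  have hle := le_of_tendsto hlim
    (by filter_upwards [Ioo_mem_nhdsGT (zero_lt_one' ℝ)] with ε hε using key ε hε)
  calc (p + c / (t - a)) * (y - t) = p * (y - t) + c * (d / (1 + 0 * d)) := by
        simp only [zero_mul, add_zero, div_one]
        rw [hd]
        ring
    _ ≤ _ := hle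

lemma mul_le_of_mul_eq_div_sq {u v l m n : ℝ} (hu : 0 < u) (hl : 0 < l)
    (hv : 0 ≤ v) (hm : 0 ≤ m) (hn : 0 < n) (h : u * l = (u + v) * (l + m) / n ^ 2) :
    v * m ≤ (n - 1) ^ 2 * ((u + v) * (l + m) / n ^ 2) := by
  obtain ⟨x, rfl⟩ : ∃ x, v = u * x := ⟨v / u, by field_simp⟩
  obtain ⟨y, rfl⟩ : ∃ y, m = l * y := ⟨m / l, by field_simp⟩
  have hx : 0 ≤ x := nonneg_of_mul_nonneg_right hv hu
  have hy : 0 ≤ y := nonneg_of_mul_nonneg_right hm hl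
  have hul : 0 < u * l := mul_pos hu hl
  rw [← h]
  have hprod : (1 + x) * (1 + y) = n ^ 2 := by
    rw [eq_div_iff (by positivity)] at h
    exact mul_left_cancel₀ hul.ne' (by linarith)
  have hamgm : 2 * n ≤ (1 + x) + (1 + y) := by
    refine le_of_sq_le_sq ?_ (by positivity)
    nlinarith [sq_nonneg (x - y)]
  have : x * y ≤ (n - 1) ^ 2 := by linarith
  calc u * x * (l * y) = u * l * (x * y) := by ring
    _ ≤ u * l * (n - 1) ^ 2 := by gcongr
    _ = _ := by ring

/-- A subdivision point balancing the two products of slope variation and length. -/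
lemma ConvexOn.exists_balanced_point {f : ℝ → ℝ} {a b p q n : ℝ} (hab : a < b) (hn : 1 < n)
    (hcont : ContinuousOn f (Set.Icc a b)) (hf : ConvexOn ℝ (Set.Icc a b) f)
    (hp : ∀ y ∈ Set.Icc a b, p * (y - a) ≤ f y - f a)
    (hq : Tendsto (fun y => (f b - f y) / (b - y)) (nhdsWithin b (Set.Iio b)) (nhds q)) :
    ∃ t ∈ Set.Ioo a b, ∃ m, (∀ y ∈ Set.Icc a b, m * (y - t) ≤ f y - f t) ∧
      (m - p) * (t - a) ≤ (q - p) * (b - a) / n ^ 2 ∧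
      (q - m) * (b - t) ≤ (n - 1) ^ 2 * ((q - p) * (b - a) / n ^ 2) := by
  have hL : 0 < b - a := sub_pos.2 hab
  have hqs := fun y hy => hf.sub_le_of_tendsto_left hab hq (y := y) hy
  have hpq : p ≤ q := by
    have h1 := hp b (Set.right_mem_Icc.2 hab.le)
    have h2 := hqs a (Set.left_mem_Icc.2 hab.le)
    exact le_of_mul_le_mul_right (h1.trans h2) hL
  rcases eq_or_lt_of_le hpq with rfl | hpq
  · have hmem : (a + b) / 2 ∈ Set.Ioo a b := ⟨by linarith, by linarith⟩
    refine ⟨(a + b) / 2, hmem, p, fun y hy => ?_, by simp, by simp⟩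
    have h1 := hp y hy
    have h2 := hqs _ (Set.Ioo_subset_Icc_self hmem)
    have h3 := hqs a (Set.left_mem_Icc.2 hab.le)
    have h4 := hp b (Set.right_mem_Icc.2 hab.le)
    have h5 := hf.2 (Set.left_mem_Icc.2 hab.le) (Set.right_mem_Icc.2 hab.le)
      (show (0 : ℝ) ≤ 1 / 2 by norm_num) (show (0 : ℝ) ≤ 1 / 2 by norm_num) (by norm_num)
    simp only [smul_eq_mul] at h5
    rw [show 1 / 2 * a + 1 / 2 * b = (a + b) / 2 by ring] at h5
    linarith
  set c := (q - p) * (b - a) / n ^ 2 with hcdef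
  have hVL : 0 < (q - p) * (b - a) := mul_pos (sub_pos.2 hpq) hL
  have hc : 0 < c := by positivity
  have hclt : c < (q - p) * (b - a) := div_lt_self hVL (by nlinarith)
  obtain ⟨t, ht, hmin⟩ := exists_forall_sub_log_le hab hc hcont hp
  have hsupp := fun y hy => hf.support_of_forall_sub_log_le hc ht hmin (y := y) hy
  have htb : t < b := by
    refine lt_of_le_of_ne ht.2 ?_
    rintro rfl
    have : q ≤ p + c / (t - a) := by
      refine le_of_tendsto hq ?_
      filter_upwards [Ioo_mem_nhdsLT hab] with y hy
      rw [div_le_iff₀ (sub_pos.2 hy.2)]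
      linarith [hsupp y ⟨hy.1.le, hy.2.le⟩]
    have h2 : q - p ≤ c / (t - a) := by linarith
    rw [le_div_iff₀ hL] at h2
    linarith
  have hta : 0 < t - a := sub_pos.2 ht.1
  have hmq : p + c / (t - a) ≤ q := by
    have h1 := hsupp b (Set.right_mem_Icc.2 hab.le)
    have h2 := hqs t ⟨ht.1.le, ht.2⟩
    exact le_of_mul_le_mul_right (h1.trans h2) (sub_pos.2 htb)
  have heq : c / (t - a) * (t - a) = c := div_mul_cancel₀ _ hta.ne'
  have hVsplit : c / (t - a) + (q - (p + c / (t - a))) = q - p := by ring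
  have hLsplit : (t - a) + (b - t) = b - a := by ring
  refine ⟨t, ⟨ht.1, htb⟩, p + c / (t - a), hsupp, by rw [add_sub_cancel_left, heq], ?_⟩
  have := mul_le_of_mul_eq_div_sq (u := c / (t - a)) (v := q - (p + c / (t - a))) (l := t - a)
    (m := b - t) (n := n) (by positivity) hta (by linarith) (by linarith) (by linarith)
    (by rw [hVsplit, hLsplit, heq])
  rwa [hVsplit, hLsplit] at this

/-- Prepending a chord to a linear interpolation. -/
lemma IsLinearInterp.cons {f l : ℝ → ℝ} {a t b : ℝ} {K : ℕ} (hat : a < t)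
    (hl : IsLinearInterp f t b K l) (hlt : l t = f t) :
    IsLinearInterp f a b (K + 1)
      (fun y => if y ≤ t then f a + (f t - f a) / (t - a) * (y - a) else l y) := by
  obtain ⟨s, hs0, hsl, hmono, hs⟩ := hl
  refine ⟨Fin.cons a s, by simp, by rw [← Fin.succ_last, Fin.cons_succ, hsl], ?_, ?_⟩
  · rw [Fin.strictMono_iff_lt_succ]
    intro i
    refine Fin.cases ?_ (fun j => ?_) i
    · simpa [hs0] using hat
    · rw [← Fin.succ_castSucc, Fin.cons_succ, Fin.cons_succ]
      exact hmono Fin.castSucc_lt_succ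
  · intro i
    refine Fin.cases ?_ (fun j => ?_) i
    · intro y hy
      simp only [Fin.castSucc_zero, Fin.cons_zero, Fin.cons_succ, hs0] at hy ⊢
      rw [if_pos hy.2]
    · rw [← Fin.succ_castSucc, Fin.cons_succ, Fin.cons_succ]
      intro y hy
      rw [← hs j y hy]
      have hty : t ≤ y := hs0 ▸ (hmono.monotone (Fin.zero_le _)).trans hy.1
      rcases eq_or_lt_of_le hty with rfl | h
      · simp only [le_refl, if_true, hlt]
        have := sub_pos.2 hat
        field_simp
        ring
      · exact if_neg h.not_ge

lemma ConvexOn.exists_isLinearInterp {f : ℝ → ℝ} {b q : ℝ}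
    (hq : Tendsto (fun y => (f b - f y) / (b - y)) (nhdsWithin b (Set.Iio b)) (nhds q))
    (K : ℕ) : ∀ {a p : ℝ}, a < b → ContinuousOn f (Set.Icc a b) → ConvexOn ℝ (Set.Icc a b) f →
      (∀ y ∈ Set.Icc a b, p * (y - a) ≤ f y - f a) →
      ∃ l : ℝ → ℝ, IsLinearInterp f a b (K + 1) l ∧ l a = f a ∧
        ∀ y ∈ Set.Icc a b, |f y - l y| ≤ (q - p) * (b - a) / (4 * ((K + 1 : ℕ) : ℝ) ^ 2) := by
  induction K with
  | zero =>
    intro a p hab hcont hf hp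
    refine ⟨fun y => f a + (f b - f a) / (b - a) * (y - a), ?_, by simp, fun y hy => ?_⟩
    · refine ⟨![a, b], rfl, rfl, ?_, ?_⟩
      · rw [Fin.strictMono_iff_lt_succ]
        intro i
        fin_cases i
        simpa using hab
      · intro i y _
        fin_cases i
        simp
    · simpa using hf.abs_sub_chord_le hab hp (fun y hy => hf.sub_le_of_tendsto_left hab hq hy) hy
  | succ K ih =>
    intro a p hab hcont hf hp
    have hn : (1 : ℝ) < ((K + 1 + 1 : ℕ) : ℝ) := by
      push_cast
      linarith [(Nat.cast_nonneg K : (0 : ℝ) ≤ K)]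
    obtain ⟨t, ht, m, hm, h1, h2⟩ := hf.exists_balanced_point hab hn hcont hp hq
    have hleft : Set.Icc a t ⊆ Set.Icc a b := Set.Icc_subset_Icc_right ht.2.le
    have hright : Set.Icc t b ⊆ Set.Icc a b := Set.Icc_subset_Icc_left ht.1.le
    obtain ⟨l, hl, hlt, herr⟩ := ih ht.2 (hcont.mono hright) (hf.subset hright (convex_Icc t b))
      (fun y hy => hm y (hright hy))
    refine ⟨_, hl.cons ht.1 hlt, by simp [ht.1.le], fun y hy => ?_⟩
    have hbound : (q - p) * (b - a) / (4 * ((K + 1 + 1 : ℕ) : ℝ) ^ 2)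
        = (q - p) * (b - a) / ((K + 1 + 1 : ℕ) : ℝ) ^ 2 / 4 := by
      field_simp
    rw [hbound]
    split_ifs with hyt
    · refine ((hf.subset hleft (convex_Icc a t)).abs_sub_chord_le ht.1
        (fun z hz => hp z (hleft hz)) (q := m) (fun z hz => ?_) ⟨hy.1, hyt⟩).trans ?_
      · linarith [hm z (hleft hz)]
      · linarith
    · refine (herr y ⟨(not_le.1 hyt).le, hy.2⟩).trans ?_
      have hK : (((K + 1 + 1 : ℕ) : ℝ) - 1) = ((K + 1 : ℕ) : ℝ) := by push_cast; ring
      rw [hK] at h2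
      have hK0 : (0 : ℝ) < ((K + 1 : ℕ) : ℝ) := by positivity
      rw [div_le_iff₀ (by positivity)]
      linarith

lemma IsLinearInterp.neg {f l : ℝ → ℝ} {a b : ℝ} {K : ℕ} (hl : IsLinearInterp f a b K l) :
    IsLinearInterp (-f) a b K (-l) := by
  obtain ⟨t, h0, hlast, hmono, h⟩ := hl
  refine ⟨t, h0, hlast, hmono, fun i y hy => ?_⟩
  simp only [Pi.neg_apply]
  rw [h i y hy]
  ring

lemma ConvexOn.exists_isLinearInterp_abs_sub_le {f : ℝ → ℝ} {a b p q : ℝ} (hab : a < b)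
    {K : ℕ} (hK : 1 ≤ K) (hcont : ContinuousOn f (Set.Icc a b))
    (hf : ConvexOn ℝ (Set.Icc a b) f)
    (hp : Tendsto (fun y => (f y - f a) / (y - a)) (nhdsWithin a (Set.Ioi a)) (nhds p))
    (hq : Tendsto (fun y => (f b - f y) / (b - y)) (nhdsWithin b (Set.Iio b)) (nhds q)) :
    ∃ l : ℝ → ℝ, IsLinearInterp f a b K l ∧
      ∀ y ∈ Set.Icc a b, |f y - l y| ≤ |p - q| * (b - a) / (4 * (K : ℝ) ^ 2) := by
  obtain ⟨k, rfl⟩ := Nat.exists_eq_add_of_le' hK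
  obtain ⟨l, hl, -, herr⟩ := hf.exists_isLinearInterp hq k hab hcont
    (fun y hy => hf.le_sub_of_tendsto_right hab hp hy)
  refine ⟨l, hl, fun y hy => (herr y hy).trans ?_⟩
  have hL := (sub_pos.2 hab).le
  gcongr
  rw [abs_sub_comm]
  exact le_abs_self _

/-- Theorem 3(i): if `f` is continuous, monotone and convex or
concave on `[a,b]` with finite one-sided derivatives `f'_r(a)` and `f'_l(b)`, then for
every probability measure `Q` on `[a,b]` and every `K ≥ 1` there exists a `K`-linear
interpolation `fbar` of `f` such that
`∫_{[a,b]} |f − fbar| dQ ≤ |f'_r(a) − f'_l(b)|·(b−a)/(4K²)`. -/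
theorem stmt10 (a b : ℝ) (hab : a < b) (Q : Measure ℝ) [IsProbabilityMeasure Q]
    (hQ : Q (Set.Icc a b)ᶜ = 0) (K : ℕ) (hK : 1 ≤ K) (f : ℝ → ℝ)
    (hcont : ContinuousOn f (Set.Icc a b))
    (hmono : MonotoneOn f (Set.Icc a b) ∨ AntitoneOn f (Set.Icc a b))
    (hcvx : ConvexOn ℝ (Set.Icc a b) f ∨ ConcaveOn ℝ (Set.Icc a b) f)
    (dra dlb : ℝ)
    (hdra : Tendsto (fun y => (f y - f a) / (y - a)) (nhdsWithin a (Set.Ioi a)) (nhds dra))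
    (hdlb : Tendsto (fun y => (f b - f y) / (b - y)) (nhdsWithin b (Set.Iio b)) (nhds dlb)) :
    ∃ fbar : ℝ → ℝ, IsLinearInterp f a b K fbar ∧
      ∫⁻ y in Set.Icc a b, ENNReal.ofReal |f y - fbar y| ∂Q
        ≤ ENNReal.ofReal (|dra - dlb| * (b - a) / (4 * K ^ 2)) := by
  obtain ⟨l, hl, herr⟩ : ∃ l : ℝ → ℝ, IsLinearInterp f a b K l ∧
      ∀ y ∈ Set.Icc a b, |f y - l y| ≤ |dra - dlb| * (b - a) / (4 * (K : ℝ) ^ 2) := by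
    rcases hcvx with hf | hf
    · exact hf.exists_isLinearInterp_abs_sub_le hab hK hcont hdra hdlb
    · obtain ⟨l, hl, herr⟩ := hf.neg.exists_isLinearInterp_abs_sub_le hab hK hcont.neg
        (p := -dra) (q := -dlb)
        (hdra.neg.congr fun y => by simp only [Pi.neg_apply]; ring)
        (hdlb.neg.congr fun y => by simp only [Pi.neg_apply]; ring)
      refine ⟨-l, by simpa using hl.neg, fun y hy => ?_⟩
      have h1 : |f y - (-l) y| = |(-f) y - l y| := by
        rw [← abs_neg]
        congr 1
        simp only [Pi.neg_apply]
        ring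
      have h2 : |dra - dlb| = |-dra - -dlb| := by
        rw [← abs_neg]
        congr 1
        ring
      rw [h1, h2]
      exact herr y hy
  refine ⟨l, hl, ?_⟩
  calc ∫⁻ y in Set.Icc a b, ENNReal.ofReal |f y - l y| ∂Q
      ≤ ∫⁻ _ in Set.Icc a b, ENNReal.ofReal (|dra - dlb| * (b - a) / (4 * K ^ 2)) ∂Q :=
        setLIntegral_mono' measurableSet_Icc fun y hy => ENNReal.ofReal_le_ofReal (herr y hy)
    _ = ENNReal.ofReal (|dra - dlb| * (b - a) / (4 * K ^ 2)) * Q (Set.Icc a b) :=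
        setLIntegral_const _ _
    _ ≤ _ := mul_le_of_le_one_right' prob_le_one
end
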